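/- arXiv:1806.00347 — 7 statements merged into one kernel-verified Lean document; each statement's English description precedes it below -/
import Mathlib

section
/- Let n ≥ 1 and consider the polynomial ring over ℂ in variables X_j indexed by j ∈ {−(2n+1),…,−1,1,…,2n+1}. Let g be the linear map of ℂ^{4n+2} with g(X_j) = X_{−j} for 1 ≤ |j| ≤ 2n and g(X_{2n+1}) = X_{2n+1}, g(X_{−(2n+1)}) = X_{−(2n+1)}. Then: (i) g has determinant 1 and preserves the symmetric bilinear form B(x,y) = Σ_{j=1}^{2n+1}(x_jy_{−j} + x_{−j}y_j), so g ∈ SO(4n+2,ℂ); (ii) the induced ℂ-algebra substitution fixes every torus-invariant polynomial. (Hence every symmetric power S^mℂ^{4n+2} of the defining representation of SO(4n+2,ℂ), of type D_{2n+1}, is w₀-pure of sign +1.) -/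
open MvPolynomial

/-- The index permutation for `w₀` of `SO(4n+2,ℂ)`: with variables indexed by
`Sum.inl i` (the variable `X_{i+1}`) and `Sum.inr i` (the variable `X_{-(i+1)}`) for
`i : Fin (2n+1)`, it swaps `X_j ↔ X_{-j}` for `1 ≤ j ≤ 2n` and fixes `X_{±(2n+1)}`. -/
def w0IdxD (n : ℕ) : Fin (2 * n + 1) ⊕ Fin (2 * n + 1) → Fin (2 * n + 1) ⊕ Fin (2 * n + 1)
  | Sum.inl i => if (i : ℕ) = 2 * n then Sum.inl i else Sum.inr i
  | Sum.inr i => if (i : ℕ) = 2 * n then Sum.inr i else Sum.inl i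

lemma w0IdxD_invol (n : ℕ) (j) : w0IdxD n (w0IdxD n j) = j := by
  rcases j with i | i <;> by_cases h : (i : ℕ) = 2 * n <;> simp [w0IdxD, h]

lemma w0IdxD_mulVec (n : ℕ) (x : Fin (2 * n + 1) ⊕ Fin (2 * n + 1) → ℂ) (k) :
    ((Matrix.of fun i j => if i = w0IdxD n j then (1 : ℂ) else 0).mulVec x) k
      = x (w0IdxD n k) := by
  have h : ∀ j, (k = w0IdxD n j) ↔ (j = w0IdxD n k) := fun j =>
    ⟨fun h => by rw [h, w0IdxD_invol], fun h => by rw [h, w0IdxD_invol]⟩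
  simp [Matrix.mulVec, dotProduct, h]

lemma det_fromBlocks_symm {m : Type*} [Fintype m] [DecidableEq m] (A B : Matrix m m ℂ) :
    (Matrix.fromBlocks A B B A).det = (A + B).det * (A - B).det := by
  have h : Matrix.fromBlocks 1 1 0 1 * Matrix.fromBlocks A B B A * Matrix.fromBlocks 1 (-1) 0 1
      = Matrix.fromBlocks (A + B) 0 B (A - B) := by
    simp only [Matrix.fromBlocks_multiply]
    congr 1 <;> simp <;> abel
  have h2 := congrArg Matrix.det h
  simpa [Matrix.det_mul, Matrix.det_fromBlocks_zero₂₁, Matrix.det_fromBlocks_zero₁₂] using h2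

lemma w0IdxD_det (n : ℕ) :
    (Matrix.of fun i j : Fin (2 * n + 1) ⊕ Fin (2 * n + 1) =>
        if i = w0IdxD n j then (1 : ℂ) else 0).det = 1 := by
  have h : (Matrix.of fun i j : Fin (2 * n + 1) ⊕ Fin (2 * n + 1) =>
        if i = w0IdxD n j then (1 : ℂ) else 0) =
      Matrix.fromBlocks
        (Matrix.diagonal fun i : Fin (2 * n + 1) => if (i : ℕ) = 2 * n then (1 : ℂ) else 0)
        (Matrix.diagonal fun i : Fin (2 * n + 1) => if (i : ℕ) = 2 * n then (0 : ℂ) else 1)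
        (Matrix.diagonal fun i : Fin (2 * n + 1) => if (i : ℕ) = 2 * n then (0 : ℂ) else 1)
        (Matrix.diagonal fun i : Fin (2 * n + 1) => if (i : ℕ) = 2 * n then (1 : ℂ) else 0) := by
    ext i j
    rcases i with i | i <;> rcases j with j | j <;> by_cases hj : (j : ℕ) = 2 * n <;>
      by_cases hij : i = j <;> simp_all [w0IdxD, Matrix.diagonal_apply]
  rw [h, det_fromBlocks_symm, Matrix.diagonal_add, Matrix.diagonal_sub, Matrix.det_diagonal,
    Matrix.det_diagonal, Fin.prod_univ_castSucc, Fin.prod_univ_castSucc]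
  have h3 : ∀ x : Fin (2 * n), (x : ℕ) ≠ 2 * n := fun x => x.2.ne
  simp [h3]

lemma coeff_aeval_scale {σ : Type*} [Fintype σ] (c : σ → ℂ) (P : MvPolynomial σ ℂ) (m : σ →₀ ℕ) :
    coeff m (aeval (fun j => c j • (X j : MvPolynomial σ ℂ)) P)
      = (∏ j, c j ^ m j) * coeff m P := by
  classical
  induction P using MvPolynomial.induction_on' with
  | monomial s a =>
    have h : aeval (fun j => c j • (X j : MvPolynomial σ ℂ)) (monomial s a)
        = monomial s ((∏ j, c j ^ s j) * a) := by
      rw [aeval_monomial, Finsupp.prod_fintype _ _ (by simp)]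
      rw [monomial_eq, Finsupp.prod_fintype _ _ (by simp)]
      simp only [smul_eq_C_mul, mul_pow, Finset.prod_mul_distrib, algebraMap_eq, map_mul,
        map_prod, map_pow]
      ring
    rw [h, coeff_monomial, coeff_monomial]
    split_ifs with hs
    · rw [hs]
    · simp
  | add p q hp hq => rw [map_add, coeff_add, hp, hq, coeff_add, mul_add]

lemma w0IdxD_fix (n : ℕ) (P : MvPolynomial (Fin (2 * n + 1) ⊕ Fin (2 * n + 1)) ℂ)
    (hP : ∀ t : Fin (2 * n + 1) → ℂˣ,
        aeval (Sum.elim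
            (fun i => (t i : ℂ) • (X (Sum.inl i) : MvPolynomial (Fin (2 * n + 1) ⊕ Fin (2 * n + 1)) ℂ))
            (fun i => (((t i)⁻¹ : ℂˣ) : ℂ) • X (Sum.inr i))) P = P) :
    aeval (fun j => (X (w0IdxD n j) : MvPolynomial (Fin (2 * n + 1) ⊕ Fin (2 * n + 1)) ℂ)) P
        = P := by
  have key : ∀ m ∈ P.support, ∀ i, m (Sum.inl i) = m (Sum.inr i) := by
    intro m hm i
    have h2 : (2 : ℂ) ≠ 0 := two_ne_zero
    let t : Fin (2 * n + 1) → ℂˣ := fun k => if k = i then Units.mk0 2 h2 else 1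
    have h := congrArg (coeff m) (hP t)
    have he : (Sum.elim
            (fun i => (t i : ℂ) • (X (Sum.inl i) : MvPolynomial (Fin (2 * n + 1) ⊕ Fin (2 * n + 1)) ℂ))
            (fun i => (((t i)⁻¹ : ℂˣ) : ℂ) • X (Sum.inr i)))
        = fun j => (Sum.elim (fun i => (t i : ℂ)) (fun i => (((t i)⁻¹ : ℂˣ) : ℂ)) j) • X j := by
      ext1 j
      rcases j with j | j <;> rfl
    rw [he, coeff_aeval_scale] at h
    have h1 := mul_right_cancel₀ (mem_support_iff.1 hm) (h.trans (one_mul _).symm)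
    rw [Fintype.prod_sum_type, Finset.prod_eq_single i, Finset.prod_eq_single i] at h1
    · simp only [Sum.elim_inl, Sum.elim_inr, t, if_true, Units.val_mk0, Units.val_inv_eq_inv_val,
        inv_pow] at h1
      rw [mul_inv_eq_one₀ (pow_ne_zero _ h2)] at h1
      exact Nat.pow_right_injective le_rfl (by exact_mod_cast h1)
    · intro b _ hb; simp [t, hb]
    · simp
    · intro b _ hb; simp [t, hb]
    · simp
  conv_lhs => rw [P.as_sum]
  conv_rhs => rw [P.as_sum]
  rw [map_sum]
  refine Finset.sum_congr rfl fun m hm => ?_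
  rw [aeval_monomial, monomial_eq, Finsupp.prod_fintype _ _ (by simp),
    Finsupp.prod_fintype _ _ (by simp), algebraMap_eq]
  congr 1
  rw [Fintype.prod_sum_type, Fintype.prod_sum_type, ← Finset.prod_mul_distrib,
    ← Finset.prod_mul_distrib]
  refine Finset.prod_congr rfl fun i _ => ?_
  rw [key m hm i]
  by_cases hi : (i : ℕ) = 2 * n
  · simp [w0IdxD, hi]
  · simp only [w0IdxD, hi, if_false]
    exact mul_comm _ _

/-- Let `g` be the linear map of `ℂ^{4n+2}` permuting the basis according to `w0IdxD n`
(i.e. `g(X_j) = X_{-j}` for `1 ≤ |j| ≤ 2n` and `g(X_{±(2n+1)}) = X_{±(2n+1)}`).  Then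
(i) `g` has determinant `1` and preserves the symmetric bilinear form
`B(x,y) = Σ_j (x_j y_{-j} + x_{-j} y_j)`, so `g ∈ SO(4n+2,ℂ)`; and (ii) the induced
algebra substitution fixes every torus-invariant polynomial.  Hence every symmetric power
of the defining representation of `SO(4n+2,ℂ)` (type `D_{2n+1}`) is `w₀`-pure of sign `+1`. -/
theorem stmt4 (n : ℕ) (hn : 1 ≤ n) :
    (Matrix.of fun i j : Fin (2 * n + 1) ⊕ Fin (2 * n + 1) =>
        if i = w0IdxD n j then (1 : ℂ) else 0).det = 1 ∧
    (∀ x y : Fin (2 * n + 1) ⊕ Fin (2 * n + 1) → ℂ,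
      (∑ i : Fin (2 * n + 1),
          (((Matrix.of fun i j => if i = w0IdxD n j then (1 : ℂ) else 0).mulVec x) (Sum.inl i) *
              ((Matrix.of fun i j => if i = w0IdxD n j then (1 : ℂ) else 0).mulVec y) (Sum.inr i) +
            ((Matrix.of fun i j => if i = w0IdxD n j then (1 : ℂ) else 0).mulVec x) (Sum.inr i) *
              ((Matrix.of fun i j => if i = w0IdxD n j then (1 : ℂ) else 0).mulVec y) (Sum.inl i)))
        = ∑ i : Fin (2 * n + 1),
            (x (Sum.inl i) * y (Sum.inr i) + x (Sum.inr i) * y (Sum.inl i))) ∧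
    (∀ P : MvPolynomial (Fin (2 * n + 1) ⊕ Fin (2 * n + 1)) ℂ,
      (∀ t : Fin (2 * n + 1) → ℂˣ,
        aeval (Sum.elim
            (fun i => (t i : ℂ) • (X (Sum.inl i) : MvPolynomial (Fin (2 * n + 1) ⊕ Fin (2 * n + 1)) ℂ))
            (fun i => (((t i)⁻¹ : ℂˣ) : ℂ) • X (Sum.inr i))) P = P) →
      aeval (fun j => (X (w0IdxD n j) : MvPolynomial (Fin (2 * n + 1) ⊕ Fin (2 * n + 1)) ℂ)) P
        = P) := by
  refine ⟨w0IdxD_det n, fun x y => ?_, w0IdxD_fix n⟩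
  refine Finset.sum_congr rfl fun i _ => ?_
  simp only [w0IdxD_mulVec]
  by_cases hi : (i : ℕ) = 2 * n
  · simp [w0IdxD, hi]
  · simp [w0IdxD, hi, add_comm]
end

section
/- Let n ≥ 1 and consider the polynomial ring over ℂ in variables X_j indexed by j ∈ {−n,…,−1,1,…,n}, and let g be the ℂ-algebra substitution with g(X_j) = X_{−j} and g(X_{−j}) = −X_j for 1 ≤ j ≤ n. Then every torus-invariant homogeneous polynomial of odd degree is zero, and for every natural number k, every torus-invariant homogeneous polynomial P of degree 2k satisfies g(P) = (−1)^k·P. (Hence the representation S^mℂ^{2n} of Sp(2n,ℂ), of type C_n, has trivial zero-weight space for odd m and is w₀-pure of sign (−1)^k for m = 2k.) -/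
open MvPolynomial

lemma coeff_scale {σ : Type*} [Fintype σ] (c : σ → ℂ) (P : MvPolynomial σ ℂ) (d : σ →₀ ℕ) :
    coeff d (aeval (fun s => c s • (X s : MvPolynomial σ ℂ)) P) = (∏ s, c s ^ d s) * coeff d P := by
  classical
  induction P using MvPolynomial.induction_on' with
  | add p q hp hq => rw [map_add, coeff_add, coeff_add, hp, hq, mul_add]
  | monomial e a =>
    have h : aeval (fun s => c s • (X s : MvPolynomial σ ℂ)) (monomial e a)
        = monomial e ((∏ s, c s ^ e s) * a) := by
      rw [aeval_monomial, monomial_eq (s := e), Finsupp.prod_fintype _ _ (by simp),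
        Finsupp.prod_fintype _ _ (by simp)]
      simp only [smul_eq_C_mul, mul_pow, Finset.prod_mul_distrib, map_mul, map_prod, map_pow,
        algebraMap_eq]
      ring
    rw [h, coeff_monomial, coeff_monomial]
    split_ifs with h
    · rw [h]
    · simp

lemma balanced {n : ℕ} (P : MvPolynomial (Fin n ⊕ Fin n) ℂ)
    (h : ∀ t : Fin n → ℂˣ,
        aeval (Sum.elim
            (fun i => (t i : ℂ) • (X (Sum.inl i) : MvPolynomial (Fin n ⊕ Fin n) ℂ))
            (fun i => (((t i)⁻¹ : ℂˣ) : ℂ) • X (Sum.inr i))) P = P)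
    (d : Fin n ⊕ Fin n →₀ ℕ) (hd : coeff d P ≠ 0) (i : Fin n) :
    d (Sum.inl i) = d (Sum.inr i) := by
  classical
  set t : Fin n → ℂˣ := Function.update 1 i (Units.mk0 2 two_ne_zero) with ht
  have e : (Sum.elim
            (fun i => (t i : ℂ) • (X (Sum.inl i) : MvPolynomial (Fin n ⊕ Fin n) ℂ))
            (fun i => (((t i)⁻¹ : ℂˣ) : ℂ) • X (Sum.inr i)))
      = fun s => (Sum.elim (fun i => (t i : ℂ)) (fun i => (((t i)⁻¹ : ℂˣ) : ℂ)) s) •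
          (X s : MvPolynomial (Fin n ⊕ Fin n) ℂ) := by
    ext1 s; cases s <;> rfl
  have h1 := congrArg (coeff d) (h t)
  rw [e, coeff_scale] at h1
  have h2 := mul_right_cancel₀ hd (h1.trans (one_mul _).symm)
  rw [Fintype.prod_sum_type, ← Finset.prod_mul_distrib, Finset.prod_eq_single i] at h2
  · simp only [Sum.elim_inl, Sum.elim_inr, ht, Function.update_self, Units.val_inv_eq_inv_val,
      Units.val_mk0, inv_pow] at h2
    rw [mul_inv_eq_one₀ (pow_ne_zero _ two_ne_zero)] at h2
    have h3 : (2:ℕ) ^ d (Sum.inl i) = 2 ^ d (Sum.inr i) := by exact_mod_cast h2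
    exact Nat.pow_right_injective le_rfl h3
  · intro j _ hj
    simp [ht, Function.update_of_ne hj]
  · simp

lemma degree_bal {n m : ℕ} (P : MvPolynomial (Fin n ⊕ Fin n) ℂ) (hP : P.IsHomogeneous m)
    (d : Fin n ⊕ Fin n →₀ ℕ) (hd : coeff d P ≠ 0)
    (hb : ∀ i, d (Sum.inl i) = d (Sum.inr i)) : m = 2 * ∑ i, d (Sum.inr i) := by
  have := hP.coeff_eq_zero (d := d)
  have h : d.degree = m := by
    by_contra h
    exact hd (this h)
  rw [← h, Finsupp.degree_eq_sum, Fintype.sum_sum_type, two_mul]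
  simp [hb]

/-- Type `C_n`: variables are indexed by `Sum.inl i` (the variable `X_{i+1}`) and `Sum.inr i`
(the variable `X_{-(i+1)}`) for `i : Fin n`.  The substitution `g` sends `X_j ↦ X_{-j}` and
`X_{-j} ↦ -X_j`.  Every torus-invariant homogeneous polynomial of odd degree is zero, and
every torus-invariant homogeneous polynomial `P` of degree `2k` satisfies `g(P) = (-1)^k • P`.
Hence `S^m ℂ^{2n}` for `Sp(2n,ℂ)` has trivial zero-weight space for odd `m` and is `w₀`-pure
of sign `(-1)^k` for `m = 2k`. -/
theorem stmt5 (n : ℕ) (hn : 1 ≤ n) :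
    (∀ m : ℕ, Odd m → ∀ P : MvPolynomial (Fin n ⊕ Fin n) ℂ, P.IsHomogeneous m →
      (∀ t : Fin n → ℂˣ,
        aeval (Sum.elim
            (fun i => (t i : ℂ) • (X (Sum.inl i) : MvPolynomial (Fin n ⊕ Fin n) ℂ))
            (fun i => (((t i)⁻¹ : ℂˣ) : ℂ) • X (Sum.inr i))) P = P) →
      P = 0) ∧
    (∀ k : ℕ, ∀ P : MvPolynomial (Fin n ⊕ Fin n) ℂ, P.IsHomogeneous (2 * k) →
      (∀ t : Fin n → ℂˣ,
        aeval (Sum.elim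
            (fun i => (t i : ℂ) • (X (Sum.inl i) : MvPolynomial (Fin n ⊕ Fin n) ℂ))
            (fun i => (((t i)⁻¹ : ℂˣ) : ℂ) • X (Sum.inr i))) P = P) →
      aeval (Sum.elim
          (fun i => (X (Sum.inr i) : MvPolynomial (Fin n ⊕ Fin n) ℂ))
          (fun i => -(X (Sum.inl i)))) P
        = ((-1 : ℂ) ^ k) • P) := by
  refine ⟨fun m hm P hP h => ?_, fun k P hP h => ?_⟩
  · ext d
    rw [coeff_zero]
    by_contra hd
    have := degree_bal P hP d hd (balanced P h d hd)
    rw [this] at hm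
    exact (Nat.not_odd_iff_even.2 (even_two_mul _)) hm
  · conv_lhs => rw [P.as_sum]
    conv_rhs => rw [P.as_sum]
    rw [map_sum, Finset.smul_sum]
    refine Finset.sum_congr rfl fun d hd => ?_
    have hd := mem_support_iff.1 hd
    have hb := balanced P h d hd
    have hk : k = ∑ i, d (Sum.inr i) := by
      have := degree_bal P hP d hd hb
      omega
    rw [aeval_monomial, monomial_eq, Finsupp.prod_fintype _ _ (by simp),
      Finsupp.prod_fintype _ _ (by simp), Fintype.prod_sum_type, Fintype.prod_sum_type, hk,
      ← Finset.prod_pow_eq_pow_sum, smul_eq_C_mul]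
    simp only [Sum.elim_inl, Sum.elim_inr, hb, algebraMap_eq, map_prod, map_pow, map_neg, map_one]
    simp only [neg_pow (X _ : MvPolynomial (Fin n ⊕ Fin n) ℂ), Finset.prod_mul_distrib]
    ring
end

section
/- Let n ≥ 1 and consider the polynomial ring over ℂ in variables X_j indexed by j ∈ {−n,…,−1,0,1,…,n}, and let g be the ℂ-algebra substitution with g(X_j) = X_{−j} for j ≠ 0 and g(X_0) = (−1)^n·X_0. Then for every natural number m, every torus-invariant homogeneous polynomial P of degree m satisfies g(P) = (−1)^{nm}·P. (Hence the representation S^mℂ^{2n+1} of SO(2n+1,ℂ), of type B_n, is w₀-pure of sign ((−1)^n)^m.) -/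
open MvPolynomial

theorem aux_monomial {σ : Type*} [Fintype σ] (d : σ →₀ ℕ) (a : ℂ) (f : σ → MvPolynomial σ ℂ) :
    aeval f (monomial d a) = a • ∏ j, f j ^ d j := by
  rw [aeval_monomial, Finsupp.prod_fintype _ _ (by simp), Algebra.smul_def]

theorem aux_monomial_eq {σ : Type*} [Fintype σ] (d : σ →₀ ℕ) (a : ℂ) :
    monomial d a = a • ∏ j, (X j : MvPolynomial σ ℂ) ^ d j := by
  rw [← aux_monomial, aeval_X_left_apply]

theorem aux_coeff {σ : Type*} [Fintype σ] (c : σ → ℂ) (P : MvPolynomial σ ℂ) (d : σ →₀ ℕ) :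
    coeff d (aeval (fun j => c j • (X j : MvPolynomial σ ℂ)) P)
      = (∏ j, c j ^ d j) * coeff d P := by
  classical
  induction P using MvPolynomial.induction_on' with
  | add p q hp hq => rw [map_add, coeff_add, hp, hq, coeff_add, mul_add]
  | monomial e a =>
    have h : aeval (fun j => c j • (X j : MvPolynomial σ ℂ)) (monomial e a)
        = (∏ j, c j ^ e j) • monomial e a := by
      rw [aux_monomial, aux_monomial_eq]
      simp only [smul_pow, Finset.prod_smul]
      rw [smul_comm]
    rw [h, coeff_smul, coeff_monomial, smul_eq_mul]
    split_ifs with h1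
    · rw [h1]
    · simp

/-- Type `B_n`: variables are indexed by `some (Sum.inl i)` (the variable `X_{i+1}`),
`some (Sum.inr i)` (the variable `X_{-(i+1)}`) for `i : Fin n`, and `none` (the variable
`X_0`).  The substitution `g` sends `X_j ↦ X_{-j}` for `j ≠ 0` and `X_0 ↦ (-1)^n·X_0`.
Every torus-invariant homogeneous polynomial `P` of degree `m` satisfies
`g(P) = (-1)^{nm} • P`.  Hence `S^m ℂ^{2n+1}` for `SO(2n+1,ℂ)` is `w₀`-pure of sign
`((-1)^n)^m`. -/
theorem stmt6 (n : ℕ) (hn : 1 ≤ n) (m : ℕ)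
    (P : MvPolynomial (Option (Fin n ⊕ Fin n)) ℂ) (hhom : P.IsHomogeneous m)
    (hinv : ∀ t : Fin n → ℂˣ,
      aeval (fun j : Option (Fin n ⊕ Fin n) =>
          match j with
          | some (Sum.inl i) => (t i : ℂ) • (X (some (Sum.inl i)) :
              MvPolynomial (Option (Fin n ⊕ Fin n)) ℂ)
          | some (Sum.inr i) => (((t i)⁻¹ : ℂˣ) : ℂ) • X (some (Sum.inr i))
          | none => X none) P = P) :
    aeval (fun j : Option (Fin n ⊕ Fin n) =>
        match j with
        | some (Sum.inl i) => (X (some (Sum.inr i)) : MvPolynomial (Option (Fin n ⊕ Fin n)) ℂ)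
        | some (Sum.inr i) => X (some (Sum.inl i))
        | none => ((-1 : ℂ)) ^ n • X none) P
      = ((-1 : ℂ)) ^ (n * m) • P := by
  classical
  have key : ∀ d ∈ P.support, ∀ i : Fin n, d (some (Sum.inl i)) = d (some (Sum.inr i)) := by
    intro d hd i
    have h2 : (2 : ℂ) ≠ 0 := two_ne_zero
    let t : Fin n → ℂˣ := Function.update 1 i (Units.mk0 2 h2)
    let c : Option (Fin n ⊕ Fin n) → ℂ := fun j =>
      match j with
      | some (Sum.inl i) => (t i : ℂ)
      | some (Sum.inr i) => (((t i)⁻¹ : ℂˣ) : ℂ)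
      | none => 1
    have h := hinv t
    have hf : (fun j => c j • (X j : MvPolynomial (Option (Fin n ⊕ Fin n)) ℂ)) =
        (fun j : Option (Fin n ⊕ Fin n) =>
          match j with
          | some (Sum.inl i) => (t i : ℂ) • (X (some (Sum.inl i)) :
              MvPolynomial (Option (Fin n ⊕ Fin n)) ℂ)
          | some (Sum.inr i) => (((t i)⁻¹ : ℂˣ) : ℂ) • X (some (Sum.inr i))
          | none => X none) := by
      funext j
      rcases j with _ | j | j
      · simp [c]
      · rfl
      · rfl
    rw [← hf] at h
    have h3 := aux_coeff c P d
    rw [h] at h3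
    have h4 : (∏ j, c j ^ d j) = 1 :=
      (mul_eq_right₀ (mem_support_iff.mp hd)).mp h3.symm
    rw [Fintype.prod_option, Fintype.prod_sum_type] at h4
    have e1 : ∏ k : Fin n, c (some (Sum.inl k)) ^ d (some (Sum.inl k))
        = 2 ^ d (some (Sum.inl i)) := by
      rw [Fintype.prod_eq_single i]
      · simp [c, t]
      · intro k hk
        simp [c, t, hk]
    have e2 : ∏ k : Fin n, c (some (Sum.inr k)) ^ d (some (Sum.inr k))
        = (2⁻¹) ^ d (some (Sum.inr i)) := by
      rw [Fintype.prod_eq_single i]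
      · simp [c, t]
      · intro k hk
        simp [c, t, hk]
    rw [e1, e2] at h4
    have h5 : (2 : ℂ) ^ d (some (Sum.inl i)) = 2 ^ d (some (Sum.inr i)) := by
      have h6 : (2 : ℂ) ^ d (some (Sum.inl i)) * (2⁻¹) ^ d (some (Sum.inr i)) = 1 := by
        simpa [c] using h4
      rw [inv_pow] at h6
      exact (mul_inv_eq_one₀ (pow_ne_zero _ h2)).mp h6
    have h7 : 2 ^ d (some (Sum.inl i)) = 2 ^ d (some (Sum.inr i)) := by exact_mod_cast h5
    exact Nat.pow_right_injective le_rfl h7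
  conv_lhs => rw [P.as_sum]
  conv_rhs => rw [P.as_sum]
  rw [map_sum, Finset.smul_sum]
  refine Finset.sum_congr rfl fun d hd => ?_
  have hk := key d hd
  have hdeg : d.degree = m := by
    rw [Finsupp.degree_eq_weight_one]
    exact hhom (mem_support_iff.mp hd)
  rw [Finsupp.degree_eq_sum, Fintype.sum_option, Fintype.sum_sum_type] at hdeg
  simp only [hk] at hdeg
  have hs : ((-1 : ℂ)) ^ (n * m) = ((-1 : ℂ) ^ n) ^ d none := by
    rw [← hdeg, ← two_mul, pow_mul, pow_add, pow_mul _ 2, ← pow_mul _ n 2, mul_comm n 2,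
      pow_mul _ 2 n]
    simp
  rw [hs, aux_monomial, aux_monomial_eq, smul_comm]
  congr 1
  simp only [Fintype.prod_option, Fintype.prod_sum_type, hk, smul_pow, smul_mul_assoc]
  rw [mul_comm (∏ i : Fin n, X (some (Sum.inr i)) ^ d (some (Sum.inr i)))]
end

section
/- Let n ≥ 1, let V = ℂ^{2n+1} with basis e_j indexed by j ∈ {−n,…,−1,0,1,…,n}, and let g : V → V be the linear map with g(e_j) = e_{−j} for j ≠ 0 and g(e_0) = (−1)^n·e_0. Then for every natural number m, the induced map ⋀^m g on the m-th exterior power acts on the zero-weight subspace of ⋀^m V as multiplication by the scalar (−1)^{nm+⌊m/2⌋}. (Hence the exterior power Λ^mℂ^{2n+1} of the defining representation of SO(2n+1,ℂ), of type B_n, is w₀-pure of sign (−1)^{nm+⌊m/2⌋}.) -/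
/-- The basis index set for `ℂ^{2n+1}` of type `B_n`: `some (Sum.inl i)` is the basis vector
`e_{i+1}`, `some (Sum.inr i)` is `e_{-(i+1)}`, and `none` is `e_0`. -/
abbrev BIdx (n : ℕ) := Option (Fin n ⊕ Fin n)

/-- The matrix of the `w₀`-representative `g` of `SO(2n+1,ℂ)`: `g(e_j) = e_{-j}` for `j ≠ 0`
and `g(e_0) = (-1)^n·e_0`. -/
def w0MatB (n : ℕ) : Matrix (BIdx n) (BIdx n) ℂ :=
  Matrix.of fun i j =>
    match i, j with
    | some (Sum.inl a), some (Sum.inr b) => if a = b then 1 else 0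
    | some (Sum.inr a), some (Sum.inl b) => if a = b then 1 else 0
    | none, none => ((-1 : ℂ)) ^ n
    | _, _ => 0

/-- The diagonal torus element `ρ(t)` of `SO(2n+1,ℂ)`: `ρ(t)e_j = t_j e_j`,
`ρ(t)e_{-j} = t_j⁻¹ e_{-j}` for `1 ≤ j ≤ n`, and `ρ(t)e_0 = e_0`. -/
def torusMatB (n : ℕ) (t : Fin n → ℂˣ) : Matrix (BIdx n) (BIdx n) ℂ :=
  Matrix.diagonal fun j =>
    match j with
    | some (Sum.inl a) => (t a : ℂ)
    | some (Sum.inr a) => (((t a)⁻¹ : ℂˣ) : ℂ)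
    | none => 1

/-- Negation on the index set. -/
def bneg (n : ℕ) : BIdx n → BIdx n
  | some (Sum.inl a) => some (Sum.inr a)
  | some (Sum.inr a) => some (Sum.inl a)
  | none => none

/-- Scalar by which `g` maps `e_j` to `e_{-j}`. -/
def bcf (n : ℕ) : BIdx n → ℂ
  | none => (-1) ^ n
  | some _ => 1

/-- Weight of the basis vector. -/
def bwt (n : ℕ) (t : Fin n → ℂˣ) : BIdx n → ℂ
  | some (Sum.inl a) => (t a : ℂ)
  | some (Sum.inr a) => (((t a)⁻¹ : ℂˣ) : ℂ)
  | none => 1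

lemma bneg_bneg (n : ℕ) (j : BIdx n) : bneg n (bneg n j) = j := by
  rcases j with _ | a | a <;> rfl

lemma bneg_eq_iff (n : ℕ) (j : BIdx n) : bneg n j = j ↔ j = none := by
  rcases j with _ | a | a <;> simp [bneg]

lemma w0_single (n : ℕ) (j : BIdx n) :
    Matrix.toLin' (w0MatB n) (Pi.single j 1) = bcf n j • Pi.single (bneg n j) 1 := by
  ext i
  rcases j with _ | a | a <;> rcases i with _ | b | b <;>
    simp [w0MatB, bcf, bneg, Pi.single_apply]

lemma torus_single (n : ℕ) (t : Fin n → ℂˣ) (j : BIdx n) :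
    Matrix.toLin' (torusMatB n t) (Pi.single j 1) = bwt n t j • Pi.single j 1 := by
  ext i
  rcases j with _ | a | a <;> rcases i with _ | b | b <;>
    simp [torusMatB, bwt, Pi.single_apply]

/-- Wedge of basis vectors. -/
noncomputable def bwedge (n m : ℕ) (f : Fin m → BIdx n) : ExteriorAlgebra ℂ (BIdx n → ℂ) :=
  ExteriorAlgebra.ιMulti ℂ m (fun i => (Pi.single (f i) 1 : BIdx n → ℂ))

lemma map_torus_bwedge (n m : ℕ) (t : Fin n → ℂˣ) (f : Fin m → BIdx n) :
    ExteriorAlgebra.map (Matrix.toLin' (torusMatB n t)) (bwedge n m f)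
      = (∏ i, bwt n t (f i)) • bwedge n m f := by
  unfold bwedge
  rw [ExteriorAlgebra.map_apply_ιMulti, ← AlternatingMap.map_smul_univ]
  congr 1
  funext i
  exact torus_single n t (f i)

lemma map_w0_bwedge (n m : ℕ) (f : Fin m → BIdx n) :
    ExteriorAlgebra.map (Matrix.toLin' (w0MatB n)) (bwedge n m f)
      = (∏ i, bcf n (f i)) • bwedge n m (bneg n ∘ f) := by
  unfold bwedge
  rw [ExteriorAlgebra.map_apply_ιMulti, ← AlternatingMap.map_smul_univ]
  congr 1
  funext i
  exact w0_single n (f i)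

lemma prod_ite_inj (n m : ℕ) (f : Fin m → BIdx n) (hf : Function.Injective f) (x : BIdx n)
    (c : ℂ) [Decidable (x ∈ Set.range f)] :
    (∏ i, if f i = x then c else 1) = if x ∈ Set.range f then c else 1 := by
  split_ifs with h
  · obtain ⟨k, rfl⟩ := h
    simp [hf.eq_iff]
  · refine Finset.prod_eq_one fun i _ => ?_
    rw [if_neg]
    exact fun hi => h ⟨i, hi⟩

lemma symm_of_wt (n m : ℕ) (f : Fin m → BIdx n) (hf : Function.Injective f)
    (h : ∀ t : Fin n → ℂˣ, ∏ i, bwt n t (f i) = 1) (a : Fin n) :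
    some (Sum.inl a) ∈ Set.range f ↔ some (Sum.inr a) ∈ Set.range f := by
  classical
  have h2 := h (Function.update 1 a (Units.mk0 2 two_ne_zero))
  have key : ∀ j : BIdx n, bwt n (Function.update 1 a (Units.mk0 2 two_ne_zero)) j =
      (if j = some (Sum.inl a) then 2 else 1) * (if j = some (Sum.inr a) then 2⁻¹ else 1) := by
    intro j
    rcases j with _ | b | b
    · simp [bwt]
    · by_cases hb : b = a
      · subst hb; simp [bwt]
      · simp [bwt, hb]
    · by_cases hb : b = a
      · subst hb; simp [bwt]
      · simp [bwt, hb]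
  simp only [key] at h2
  rw [Finset.prod_mul_distrib, prod_ite_inj n m f hf, prod_ite_inj n m f hf] at h2
  split_ifs at h2 with h3 h4 h4
  · tauto
  · norm_num at h2
  · norm_num at h2
  · tauto

lemma w0_symm (n m : ℕ) (f : Fin m → BIdx n) (hf : Function.Injective f)
    (h : ∀ a : Fin n, some (Sum.inl a) ∈ Set.range f ↔ some (Sum.inr a) ∈ Set.range f) :
    ExteriorAlgebra.map (Matrix.toLin' (w0MatB n)) (bwedge n m f)
      = ((-1 : ℂ)) ^ (n * m + m / 2) • bwedge n m f := by
  classical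
  have h1 : ∀ i, ∃ k, f k = bneg n (f i) := by
    intro i
    rcases hi : f i with _ | a | a
    · exact ⟨i, hi⟩
    · exact (h a).1 ⟨i, hi⟩
    · exact (h a).2 ⟨i, hi⟩
  choose s hs using h1
  have hinv : Function.Involutive s := by
    intro i
    apply hf
    rw [hs, hs, bneg_bneg]
  let σ : Equiv.Perm (Fin m) := hinv.toPerm
  have hσ : σ ^ 2 = 1 := by
    ext i
    simp [σ, pow_two, hinv i]
  have hw : bwedge n m (bneg n ∘ f) = Equiv.Perm.sign σ • bwedge n m f := by
    unfold bwedge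
    rw [← AlternatingMap.map_perm]
    congr 1
    funext i
    simp [σ, hs]
  have hsign := Equiv.Perm.sign_of_pow_two_eq_one hσ
  have hfix : ∀ i, s i = i ↔ f i = none := by
    intro i
    rw [← bneg_eq_iff, ← hs, hf.eq_iff]
  have hdvd : (Fintype.card (Fin m) - Fintype.card (Function.fixedPoints σ)) % 2 = 0 ∧
      Fintype.card (Function.fixedPoints σ) ≤ m := by
    have e1 := σ.sum_cycleType
    rw [Equiv.Perm.cycleType_of_pow_prime_eq_one hσ] at e1
    have e2 := σ.card_fixedPoints
    have e3 := σ.sum_cycleType_le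
    rw [Equiv.Perm.cycleType_of_pow_prime_eq_one hσ] at e3
    rw [Equiv.Perm.cycleType_of_pow_prime_eq_one hσ] at e2
    simp at e1 e2 e3 ⊢
    omega
  have hprod : (∏ i, bcf n (f i)) = if none ∈ Set.range f then (-1 : ℂ) ^ n else 1 := by
    rw [← prod_ite_inj n m f hf]
    refine Finset.prod_congr rfl fun i _ => ?_
    rcases f i with _ | a <;> simp [bcf]
  rw [map_w0_bwedge, hw, hsign, hprod]
  have hcard : Fintype.card (Function.fixedPoints σ) = if none ∈ Set.range f then 1 else 0 := by
    split_ifs with h0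
    · obtain ⟨k, hk⟩ := h0
      rw [Fintype.card_eq_one_iff]
      refine ⟨⟨k, (hfix k).2 hk⟩, ?_⟩
      rintro ⟨y, hy⟩
      have : f y = none := (hfix y).1 hy
      exact Subtype.ext (hf (this.trans hk.symm))
    · rw [Fintype.card_eq_zero_iff]
      refine ⟨?_⟩
      rintro ⟨y, hy⟩
      exact h0 ⟨y, (hfix y).1 hy⟩
  rw [hcard] at hdvd ⊢
  rw [Units.smul_def, ← Int.cast_smul_eq_zsmul ℂ, smul_smul]
  congr 1
  rw [Fintype.card_fin] at *
  split_ifs at * with h0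
  · obtain ⟨k, rfl⟩ : ∃ k, m = 2 * k + 1 := ⟨m / 2, by omega⟩
    have e1 : (2 * k + 1 - 1) / 2 = k := by omega
    have e2 : (2 * k + 1) / 2 = k := by omega
    rw [e1, e2]
    have : n * (2 * k + 1) + k = 2 * (n * k) + n + k := by ring
    rw [this, pow_add, pow_add, pow_mul]
    simp
  · obtain ⟨k, rfl⟩ : ∃ k, m = 2 * k := ⟨m / 2, by omega⟩
    have e1 : (2 * k - 0) / 2 = k := by omega
    have e2 : (2 * k) / 2 = k := by omega
    rw [e1, e2]
    have : n * (2 * k) + k = 2 * (n * k) + k := by ring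
    rw [this, pow_add, pow_mul]
    simp


/-- The induced map `⋀^m g` acts on the zero-weight subspace of `⋀^m ℂ^{2n+1}` as
multiplication by `(-1)^{nm+⌊m/2⌋}`.  Hence `Λ^m ℂ^{2n+1}` for `SO(2n+1,ℂ)` (type `B_n`)
is `w₀`-pure of sign `(-1)^{nm+⌊m/2⌋}`. -/
theorem stmt7 (n : ℕ) (hn : 1 ≤ n) (m : ℕ)
    (v : ExteriorAlgebra ℂ (BIdx n → ℂ)) (hv : v ∈ ⋀[ℂ]^m (BIdx n → ℂ))
    (hinv : ∀ t : Fin n → ℂˣ,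
      ExteriorAlgebra.map (Matrix.toLin' (torusMatB n t)) v = v) :
    ExteriorAlgebra.map (Matrix.toLin' (w0MatB n)) v
      = ((-1 : ℂ)) ^ (n * m + m / 2) • v := by
  classical
  let e := Fintype.equivFin (BIdx n)
  let b := (Pi.basisFun ℂ (BIdx n)).reindex e
  let B := b.exteriorPower m
  let _ : Fintype (Set.powersetCard (Fin (Fintype.card (BIdx n))) m) := Fintype.ofFinite _
  let f : Set.powersetCard (Fin (Fintype.card (BIdx n))) m → Fin m → BIdx n :=
    fun s i => e.symm (Set.powersetCard.ofFinEmbEquiv.symm s i)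
  have hf : ∀ s, Function.Injective (f s) := fun s =>
    e.symm.injective.comp (Set.powersetCard.ofFinEmbEquiv.symm s).injective
  have hB : ∀ s, ((B s : ⋀[ℂ]^m (BIdx n → ℂ)) : ExteriorAlgebra ℂ (BIdx n → ℂ))
      = bwedge n m (f s) := by
    intro s
    simp only [B]
    rw [exteriorPower.basis_apply]
    unfold exteriorPower.ιMulti_family bwedge
    rw [exteriorPower.ιMulti_apply_coe]
    congr 1
    funext i
    simp [b, f]
  have hli : LinearIndependent ℂ (fun s => bwedge n m (f s)) := by
    have := B.linearIndependent.map' (Submodule.subtype _) (Submodule.ker_subtype _)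
    have h2 : (fun s => bwedge n m (f s)) = (Submodule.subtype (⋀[ℂ]^m (BIdx n → ℂ))) ∘ B := by
      funext s
      exact (hB s).symm
    rw [h2]
    exact this
  obtain ⟨c, hc⟩ : ∃ c : Set.powersetCard (Fin (Fintype.card (BIdx n))) m → ℂ,
      v = ∑ s, c s • bwedge n m (f s) := by
    refine ⟨fun s => B.repr ⟨v, hv⟩ s, ?_⟩
    have := congrArg Subtype.val (B.sum_repr ⟨v, hv⟩)
    refine this.symm.trans ?_
    rw [Submodule.coe_sum]
    refine Finset.sum_congr rfl fun s _ => ?_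
    rw [Submodule.coe_smul, hB]
  have hcs : ∀ s, c s ≠ 0 → ∀ t, ∏ i, bwt n t (f s i) = 1 := by
    intro s hs t
    have h1 := hinv t
    rw [hc, map_sum] at h1
    simp only [map_smul, map_torus_bwedge, smul_smul] at h1
    have h2 := hli.eq_coords_of_eq h1 s
    exact mul_left_cancel₀ hs (by rw [h2, mul_one])
  rw [hc, map_sum, Finset.smul_sum]
  refine Finset.sum_congr rfl fun s _ => ?_
  by_cases hs : c s = 0
  · simp [hs]
  · rw [map_smul, w0_symm n m (f s) (hf s) (symm_of_wt n m (f s) (hf s) (hcs s hs)), smul_comm]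
end

section
/- Let n ≥ 2 be even, let V = ℂ^{2n} with basis e_j indexed by j ∈ {−n,…,−1,1,…,n}, and let g : V → V be the linear map with g(e_j) = e_{−j} for all j. Then for every odd m the zero-weight subspace of ⋀^m V is zero, and for every natural number k the induced map ⋀^{2k} g acts on the zero-weight subspace of ⋀^{2k} V as multiplication by (−1)^k. (Hence the exterior power Λ^{2k}ℂ^{2n} of the defining representation of SO(2n,ℂ) with n even, of type D_n, is w₀-pure of sign (−1)^k.) -/
/-- The basis index set for `ℂ^{2n}`: `Sum.inl i` is the basis vector `e_{i+1}` and
`Sum.inr i` is `e_{-(i+1)}`. -/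
abbrev DIdx (n : ℕ) := Fin n ⊕ Fin n

/-- The matrix of the `w₀`-representative `g` of `SO(2n,ℂ)` for `n` even:
`g(e_j) = e_{-j}` for all `j`. -/
def w0MatD (n : ℕ) : Matrix (DIdx n) (DIdx n) ℂ :=
  Matrix.of fun i j =>
    match i, j with
    | Sum.inl a, Sum.inr b => if a = b then 1 else 0
    | Sum.inr a, Sum.inl b => if a = b then 1 else 0
    | _, _ => 0

/-- The diagonal torus element `ρ(t)`: `ρ(t)e_j = t_j e_j` and `ρ(t)e_{-j} = t_j⁻¹ e_{-j}`
for `1 ≤ j ≤ n`. -/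
def torusMatD (n : ℕ) (t : Fin n → ℂˣ) : Matrix (DIdx n) (DIdx n) ℂ :=
  Matrix.diagonal fun j =>
    match j with
    | Sum.inl a => (t a : ℂ)
    | Sum.inr a => (((t a)⁻¹ : ℂˣ) : ℂ)

/-- The basis vector. -/
noncomputable def eD (n : ℕ) (j : DIdx n) : DIdx n → ℂ := Pi.single j 1

theorem w0_eD (n : ℕ) (j : DIdx n) : Matrix.toLin' (w0MatD n) (eD n j) = eD n j.swap := by
  ext i
  rcases i with i | i <;> rcases j with j | j <;>
    simp [eD, w0MatD, Matrix.toLin'_apply, Matrix.col_apply, Pi.single_apply]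

/-- Diagonal entries. -/
def cD (n : ℕ) (t : Fin n → ℂˣ) (j : DIdx n) : ℂ :=
  match j with
  | Sum.inl a => (t a : ℂ)
  | Sum.inr a => (((t a)⁻¹ : ℂˣ) : ℂ)

theorem torus_eD (n : ℕ) (t : Fin n → ℂˣ) (j : DIdx n) :
    Matrix.toLin' (torusMatD n t) (eD n j) = cD n t j • eD n j := by
  ext i
  by_cases h : i = j
  · subst h
    rcases i with i | i <;>
    simp [eD, torusMatD, cD, Matrix.toLin'_apply]
  · simp [eD, torusMatD, Matrix.toLin'_apply, h]

theorem torus_mul (n : ℕ) (s t : Fin n → ℂˣ) :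
    torusMatD n (s * t) = torusMatD n s * torusMatD n t := by
  unfold torusMatD
  rw [Matrix.diagonal_mul_diagonal]
  congr 1
  ext j
  rcases j with j | j <;> simp [mul_comm]

/-- Wedge monomials. -/
noncomputable def xD (n m : ℕ) (f : Fin m → DIdx n) : ExteriorAlgebra ℂ (DIdx n → ℂ) :=
  ExteriorAlgebra.ιMulti ℂ m (fun i => eD n (f i))

theorem torus_xD (n m : ℕ) (t : Fin n → ℂˣ) (f : Fin m → DIdx n) :
    ExteriorAlgebra.map (Matrix.toLin' (torusMatD n t)) (xD n m f)
      = (∏ i, cD n t (f i)) • xD n m f := by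
  unfold xD
  rw [ExteriorAlgebra.map_apply_ιMulti, ← AlternatingMap.map_smul_univ]
  congr 1
  ext1 i
  exact torus_eD n t (f i)

theorem w0_xD (n m : ℕ) (f : Fin m → DIdx n) :
    ExteriorAlgebra.map (Matrix.toLin' (w0MatD n)) (xD n m f)
      = xD n m (fun i => (f i).swap) := by
  unfold xD
  rw [ExteriorAlgebra.map_apply_ιMulti]
  congr 1
  ext1 i
  exact w0_eD n (f i)

/-- Sign vectors as torus elements. -/
def uD (n : ℕ) : (Fin n → ℤˣ) →* (Fin n → ℂˣ) :=
  (Units.map (Int.castRingHom ℂ).toMonoidHom).compLeft (Fin n)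

/-- The averaging operator. -/
noncomputable def PD (n : ℕ) : ExteriorAlgebra ℂ (DIdx n → ℂ) →ₗ[ℂ] ExteriorAlgebra ℂ (DIdx n → ℂ) :=
  ∑ t : Fin n → ℤˣ, (ExteriorAlgebra.map (Matrix.toLin' (torusMatD n (uD n t)))).toLinearMap

theorem PD_apply (n : ℕ) (v : ExteriorAlgebra ℂ (DIdx n → ℂ)) :
    PD n v = ∑ t : Fin n → ℤˣ, ExteriorAlgebra.map (Matrix.toLin' (torusMatD n (uD n t))) v := by
  simp [PD]

theorem torus_PD (n : ℕ) (s : Fin n → ℤˣ) (v : ExteriorAlgebra ℂ (DIdx n → ℂ)) :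
    ExteriorAlgebra.map (Matrix.toLin' (torusMatD n (uD n s))) (PD n v) = PD n v := by
  rw [PD_apply, map_sum, ← Equiv.sum_comp (Equiv.mulLeft s)
    (fun t => ExteriorAlgebra.map (Matrix.toLin' (torusMatD n (uD n t))) v)]
  refine Finset.sum_congr rfl fun t _ => ?_
  rw [Equiv.coe_mulLeft, map_mul, torus_mul, Matrix.toLin'_mul, ← ExteriorAlgebra.map_comp_map]
  rfl

theorem PD_xD (n m : ℕ) (f : Fin m → DIdx n) : ∃ c : ℂ, PD n (xD n m f) = c • xD n m f := by
  refine ⟨∑ t : Fin n → ℤˣ, ∏ i, cD n (uD n t) (f i), ?_⟩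
  rw [PD_apply, Finset.sum_smul]
  exact Finset.sum_congr rfl fun t _ => torus_xD _ _ _ _

theorem PD_xD_zero (n m : ℕ) (f : Fin m → DIdx n) (hf : Function.Injective f) (i0 : Fin m)
    (h : ∀ j, f j ≠ (f i0).swap) : PD n (xD n m f) = 0 := by
  obtain ⟨s, hs1, hs2⟩ : ∃ s : Fin n → ℤˣ, cD n (uD n s) (f i0) = -1 ∧
      ∀ j, j ≠ f i0 → j ≠ (f i0).swap → cD n (uD n s) j = 1 := by
    generalize f i0 = j0
    rcases j0 with a | a <;> refine ⟨Function.update 1 a (-1), by simp [cD, uD], ?_⟩ <;>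
      rintro (b | b) h1 h2 <;> simp at h1 h2 <;> simp [cD, uD, Function.update_of_ne, *]
  have hp : ∏ i, cD n (uD n s) (f i) = -1 := by
    rw [Finset.prod_eq_single i0, hs1]
    · intro i _ hi
      exact hs2 _ (fun e => hi (hf e)) (h i)
    · simp
  obtain ⟨c, hc⟩ := PD_xD n m f
  have h1 := torus_PD n s (xD n m f)
  rw [hc, map_smul, torus_xD, hp] at h1
  rw [hc]
  have h3 : (2 : ℂ) • (c • xD n m f) = 0 := by
    rw [two_smul]
    nth_rewrite 1 [← h1]
    simp
  simpa using h3

theorem sign_inv (m : ℕ) (p : Equiv.Perm (Fin m)) (h2 : ∀ i, p (p i) = i) (h1 : ∀ i, p i ≠ i) :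
    ∃ k, m = 2 * k ∧ Equiv.Perm.sign p = (-1) ^ k := by
  have hc : ∀ x ∈ p.cycleType, x = 2 := by
    intro x hx
    have hd : orderOf p ∣ 2 := orderOf_dvd_of_pow_eq_one (by ext i; simp [pow_two, h2])
    have := Equiv.Perm.two_le_of_mem_cycleType hx
    have h3 := Nat.le_of_dvd (by norm_num) ((Equiv.Perm.dvd_of_mem_cycleType hx).trans hd)
    omega
  have hs : p.cycleType.sum = m := by
    rw [Equiv.Perm.sum_cycleType]
    have : p.support = Finset.univ := by ext i; simp [h1]
    simp [this]
  have hr := Multiset.eq_replicate_card.2 hc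
  have hm : m = 2 * p.cycleType.card := by
    conv_lhs => rw [← hs, hr]
    simp [mul_comm]
  refine ⟨_, hm, ?_⟩
  rw [Equiv.Perm.sign_of_cycleType, hs, pow_add]
  have he : Even m := ⟨p.cycleType.card, by omega⟩
  rw [he.neg_one_pow, one_mul]

theorem key (n m : ℕ) (v : ExteriorAlgebra ℂ (DIdx n → ℂ)) (hv : v ∈ ⋀[ℂ]^m (DIdx n → ℂ)) :
    (Odd m → PD n v = 0) ∧ (∀ k, m = 2 * k →
      ExteriorAlgebra.map (Matrix.toLin' (w0MatD n)) (PD n v) = (-1 : ℂ) ^ k • PD n v) := by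
  have hspan : Submodule.span ℂ (Set.range (eD n)) = ⊤ := by
    have := (Pi.basisFun ℂ (DIdx n)).span_eq
    convert this using 3
    ext j
    simp [eD]
  rw [← exteriorPower.ιMulti_span_fixedDegree_of_span_eq_top ℂ m _ hspan] at hv
  induction hv using Submodule.span_induction with
  | zero => simp
  | add x y _ _ hx hy =>
    refine ⟨fun h => by rw [map_add, hx.1 h, hy.1 h, add_zero], fun k hk => ?_⟩
    rw [map_add, map_add, hx.2 k hk, hy.2 k hk, smul_add]
  | smul c x _ hx =>
    refine ⟨fun h => by rw [map_smul, hx.1 h, smul_zero], fun k hk => ?_⟩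
    rw [map_smul, map_smul, hx.2 k hk, smul_comm]
  | mem x hx =>
    obtain ⟨f, rfl⟩ : ∃ f, x = xD n m f := by
      obtain ⟨a, ha, rfl⟩ := hx
      have ha' : ∀ i, ∃ j, eD n j = a i := fun i => ha ⟨i, rfl⟩
      choose f hf using ha'
      exact ⟨f, by simp [xD, hf]⟩
    by_cases hf : Function.Injective f
    swap
    · have : xD n m f = 0 := by
        apply AlternatingMap.map_eq_zero_of_not_injective
        intro h
        exact hf fun i j hij => h (by simp [hij])
      simp [this]
    by_cases hs : ∀ i, ∃ j, f j = (f i).swap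
    swap
    · push Not at hs
      obtain ⟨i0, h⟩ := hs
      simp [PD_xD_zero n m f hf i0 h]
    choose p hp using hs
    have hpp : ∀ i, p (p i) = i := fun i => hf (by simp [hp])
    have hp1 : ∀ i, p i ≠ i := by
      intro i h
      have := hp i
      rw [h] at this
      rcases hfi : f i with a | a <;> simp [hfi] at this
    let q : Equiv.Perm (Fin m) := ⟨p, p, hpp, hpp⟩
    obtain ⟨k, hk, hsg⟩ := sign_inv m q hpp hp1
    refine ⟨fun h => by grind, fun k' hk' => ?_⟩
    obtain rfl : k' = k := by omega
    obtain ⟨c, hc⟩ := PD_xD n m f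
    have hx : xD n m (fun i => (f i).swap) = (-1 : ℂ) ^ k' • xD n m f := by
      have := AlternatingMap.map_perm (ExteriorAlgebra.ιMulti ℂ m) (fun i => eD n (f i)) q
      rw [hsg] at this
      have e : (fun i => eD n (f i)) ∘ q = fun i => eD n ((f i).swap) := by
        ext1 i
        simp [q, hp]
      rw [e] at this
      unfold xD
      rw [this]
      rcases neg_one_pow_eq_or ℤˣ k' with h | h <;>
        rcases Nat.even_or_odd k' with h' | h' <;> simp_all
    rw [hc, map_smul, w0_xD, hx, smul_comm]

theorem PD_fixed (n : ℕ) (v : ExteriorAlgebra ℂ (DIdx n → ℂ))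
    (h : ∀ t : Fin n → ℂˣ, ExteriorAlgebra.map (Matrix.toLin' (torusMatD n t)) v = v) :
    ∃ c : ℂ, v = c • PD n v := by
  refine ⟨((2 : ℂ) ^ n)⁻¹, ?_⟩
  rw [PD_apply]
  simp only [h]
  simp [← Nat.cast_smul_eq_nsmul ℂ, smul_smul]

/-- For `n ≥ 2` even: the zero-weight subspace of `⋀^m ℂ^{2n}` vanishes for odd `m`, and
`⋀^{2k} g` acts on the zero-weight subspace of `⋀^{2k} ℂ^{2n}` as multiplication by
`(-1)^k`.  Hence `Λ^{2k} ℂ^{2n}` for `SO(2n,ℂ)` with `n` even (type `D_n`) is `w₀`-pure of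
sign `(-1)^k`. -/
theorem stmt8 (n : ℕ) (hn : 2 ≤ n) (hneven : Even n) :
    (∀ m : ℕ, Odd m → ∀ v : ExteriorAlgebra ℂ (DIdx n → ℂ), v ∈ ⋀[ℂ]^m (DIdx n → ℂ) →
      (∀ t : Fin n → ℂˣ,
        ExteriorAlgebra.map (Matrix.toLin' (torusMatD n t)) v = v) →
      v = 0) ∧
    (∀ k : ℕ, ∀ v : ExteriorAlgebra ℂ (DIdx n → ℂ), v ∈ ⋀[ℂ]^(2 * k) (DIdx n → ℂ) →
      (∀ t : Fin n → ℂˣ,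
        ExteriorAlgebra.map (Matrix.toLin' (torusMatD n t)) v = v) →
      ExteriorAlgebra.map (Matrix.toLin' (w0MatD n)) v = ((-1 : ℂ)) ^ k • v) := by

  refine ⟨fun m hm v hv h => ?_, fun k v hv h => ?_⟩
  · obtain ⟨c, hc⟩ := PD_fixed n v h
    rw [hc, (key n m v hv).1 hm, smul_zero]
  · obtain ⟨c, hc⟩ := PD_fixed n v h
    rw [hc, map_smul, (key n _ v hv).2 k rfl, smul_comm]
end

section
/- Let n ≥ 3, let λ_1 ≥ λ_2 ≥ ⋯ ≥ λ_n be integers with Σ_{i=1}^n λ_i = 0, and let 1 < ℓ < n be an index with λ_{ℓ−1} + λ_ℓ ≥ 0 ≥ λ_ℓ + λ_{ℓ+1}. Define integers μ_2, …, μ_{n−1} by μ_j = λ_{j−1} for 2 ≤ j < ℓ, μ_ℓ = λ_{ℓ−1} + λ_ℓ + λ_{ℓ+1}, and μ_j = λ_{j+1} for ℓ < j ≤ n−1. Then μ_2 ≥ μ_3 ≥ ⋯ ≥ μ_{n−1}, Σ_{j=2}^{n−1} μ_j = 0, and for every 2 ≤ k ≤ n−2 one has Σ_{j=2}^{k} μ_j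 = min(Σ_{i=1}^{k−1} λ_i, Σ_{i=1}^{k+1} λ_i). In particular, the sequence (μ_j) does not depend on the choice of the index ℓ satisfying the stated condition. -/
/-- Monotonicity over arbitrary gaps. -/
theorem stmt18_anti (n : ℕ) (lam : ℕ → ℤ)
    (hlam : ∀ i, 1 ≤ i → i < n → lam (i + 1) ≤ lam i)
    (i j : ℕ) (hi : 1 ≤ i) (hij : i ≤ j) (hj : j ≤ n) : lam j ≤ lam i := by
  induction j, hij using Nat.le_induction with
  | base => exact le_rfl
  | succ j hij ih => exact (hlam j (by omega) (by omega)).trans (ih (by omega))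

/-- Partial sums of `mu`, for the full range `1 ≤ k ≤ n - 1`. -/
theorem stmt18_partial (n : ℕ) (lam : ℕ → ℤ)
    (l : ℕ) (hl1 : 1 < l) (mu : ℕ → ℤ)
    (hmu1 : ∀ j, 2 ≤ j → j < l → mu j = lam (j - 1))
    (hmu2 : mu l = lam (l - 1) + lam l + lam (l + 1))
    (hmu3 : ∀ j, l < j → j ≤ n - 1 → mu j = lam (j + 1))
    (k : ℕ) (hk : k + 1 ≤ n - 1) :
    ∑ j ∈ Finset.Icc 2 (k + 1), mu j =
      if k + 1 < l then ∑ i ∈ Finset.Icc 1 k, lam i else ∑ i ∈ Finset.Icc 1 (k + 2), lam i := by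
  induction k with
  | zero => simp [hl1]
  | succ k ih =>
    have ih := ih (by omega)
    rw [Finset.sum_Icc_succ_top (by omega), ih]
    rcases lt_trichotomy (k + 2) l with h | h | h
    · rw [if_pos (by omega), if_pos (by omega), Finset.sum_Icc_succ_top (by omega),
        hmu1 _ (by omega) (by omega)]
      rfl
    · subst h
      rw [if_pos (by omega), if_neg (by omega), Finset.sum_Icc_succ_top (by omega),
        Finset.sum_Icc_succ_top (by omega), Finset.sum_Icc_succ_top (by omega), hmu2]
      simp only [Nat.add_sub_cancel, show k + 2 - 1 = k + 1 by omega]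
      ring
    · rw [if_neg (by omega), if_neg (by omega), hmu3 _ (by omega) (by omega),
        Finset.sum_Icc_succ_top (b := k + 2) (by omega)]

/-- The minimum formula, for the full range `1 ≤ k ≤ n - 1`. -/
theorem stmt18_min (n : ℕ) (lam : ℕ → ℤ)
    (hlam : ∀ i, 1 ≤ i → i < n → lam (i + 1) ≤ lam i)
    (l : ℕ) (hl1 : 1 < l) (hl2 : l < n)
    (hge : 0 ≤ lam (l - 1) + lam l) (hle : lam l + lam (l + 1) ≤ 0)
    (mu : ℕ → ℤ)
    (hmu1 : ∀ j, 2 ≤ j → j < l → mu j = lam (j - 1))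
    (hmu2 : mu l = lam (l - 1) + lam l + lam (l + 1))
    (hmu3 : ∀ j, l < j → j ≤ n - 1 → mu j = lam (j + 1))
    (k : ℕ) (hk : k + 1 ≤ n - 1) :
    ∑ j ∈ Finset.Icc 2 (k + 1), mu j =
      min (∑ i ∈ Finset.Icc 1 k, lam i) (∑ i ∈ Finset.Icc 1 (k + 2), lam i) := by
  have anti := stmt18_anti n lam hlam
  rw [stmt18_partial n lam l hl1 mu hmu1 hmu2 hmu3 k hk,
    Finset.sum_Icc_succ_top (b := k + 1) (by omega), Finset.sum_Icc_succ_top (b := k) (by omega)]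
  simp only [add_assoc, Nat.reduceAdd]
  split_ifs with h
  · have h1 := anti (k + 1) (l - 1) (by omega) (by omega) (by omega)
    have h2 := anti (k + 2) l (by omega) (by omega) (by omega)
    rw [min_eq_left]
    linarith
  · have h1 := anti l (k + 1) (by omega) (by omega) (by omega)
    have h2 := anti (l + 1) (k + 2) (by omega) (by omega) (by omega)
    rw [min_eq_right]
    linarith

/-- The type-A construction of the dominant radical weight `μ` of `sl(n-2,ℂ)` from a
dominant radical weight `λ = (λ_1 ≥ ⋯ ≥ λ_n)` of `sl(n,ℂ)` (coordinates in the standard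
basis, summing to zero): choosing any index `1 < ℓ < n` with
`λ_{ℓ-1} + λ_ℓ ≥ 0 ≥ λ_ℓ + λ_{ℓ+1}` and setting `μ_j = λ_{j-1}` for `j < ℓ`,
`μ_ℓ = λ_{ℓ-1} + λ_ℓ + λ_{ℓ+1}`, `μ_j = λ_{j+1}` for `j > ℓ`, the sequence
`μ_2 ≥ ⋯ ≥ μ_{n-1}` is nonincreasing, sums to zero, its partial sums satisfy
`Σ_{j=2}^k μ_j = min(Σ_{i=1}^{k-1} λ_i, Σ_{i=1}^{k+1} λ_i)`, and in particular `μ` does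
not depend on the choice of `ℓ`. -/
theorem stmt18 (n : ℕ) (hn : 3 ≤ n) (lam : ℕ → ℤ)
    (hlam : ∀ i, 1 ≤ i → i < n → lam (i + 1) ≤ lam i)
    (hsum : ∑ i ∈ Finset.Icc 1 n, lam i = 0)
    (l : ℕ) (hl1 : 1 < l) (hl2 : l < n)
    (hge : 0 ≤ lam (l - 1) + lam l) (hle : lam l + lam (l + 1) ≤ 0)
    (mu : ℕ → ℤ)
    (hmu1 : ∀ j, 2 ≤ j → j < l → mu j = lam (j - 1))
    (hmu2 : mu l = lam (l - 1) + lam l + lam (l + 1))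
    (hmu3 : ∀ j, l < j → j ≤ n - 1 → mu j = lam (j + 1)) :
    (∀ j, 2 ≤ j → j < n - 1 → mu (j + 1) ≤ mu j) ∧
    (∑ j ∈ Finset.Icc 2 (n - 1), mu j = 0) ∧
    (∀ k, 2 ≤ k → k ≤ n - 2 →
      ∑ j ∈ Finset.Icc 2 k, mu j
        = min (∑ i ∈ Finset.Icc 1 (k - 1), lam i) (∑ i ∈ Finset.Icc 1 (k + 1), lam i)) ∧
    (∀ l' : ℕ, 1 < l' → l' < n →
      0 ≤ lam (l' - 1) + lam l' → lam l' + lam (l' + 1) ≤ 0 →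
      ∀ mu' : ℕ → ℤ,
        (∀ j, 2 ≤ j → j < l' → mu' j = lam (j - 1)) →
        mu' l' = lam (l' - 1) + lam l' + lam (l' + 1) →
        (∀ j, l' < j → j ≤ n - 1 → mu' j = lam (j + 1)) →
        ∀ j, 2 ≤ j → j ≤ n - 1 → mu' j = mu j) := by
  have anti := stmt18_anti n lam hlam
  have key := stmt18_min n lam hlam l hl1 hl2 hge hle mu hmu1 hmu2 hmu3
  refine ⟨?_, ?_, ?_, ?_⟩
  · intro j hj hjn
    rcases lt_trichotomy (j + 1) l with h | h | h
    · rw [hmu1 j hj (by omega), hmu1 (j + 1) (by omega) h]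
      exact anti _ _ (by omega) (by omega) (by omega)
    · rw [hmu1 j hj (by omega), h, hmu2]
      have := anti (j - 1) (l - 1) (by omega) (by omega) (by omega)
      linarith
    · rw [hmu3 (j + 1) (by omega) (by omega)]
      rcases Nat.lt_or_ge l j with h' | h'
      · rw [hmu3 j h' (by omega)]
        exact anti _ _ (by omega) (by omega) (by omega)
      · obtain rfl : j = l := by omega
        rw [hmu2]
        have := anti (j + 1) (j + 1 + 1) (by omega) (by omega) (by omega)
        linarith
  · have h := stmt18_partial n lam l hl1 mu hmu1 hmu2 hmu3 (n - 2) (by omega)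
    rw [if_neg (by omega), show n - 2 + 1 = n - 1 by omega, show n - 2 + 2 = n by omega,
      hsum] at h
    exact h
  · intro k hk hkn
    obtain ⟨m, rfl⟩ : ∃ m, k = m + 1 := ⟨k - 1, by omega⟩
    exact key m (by omega)
  · intro l' hl1' hl2' hge' hle' mu' hmu1' hmu2' hmu3' j hj hjn
    have key' := stmt18_min n lam hlam l' hl1' hl2' hge' hle' mu' hmu1' hmu2' hmu3'
    obtain ⟨m, rfl⟩ : ∃ m, j = m + 1 + 1 := ⟨j - 2, by omega⟩
    have a := key m (by omega)
    have a' := key' m (by omega)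
    have b := key (m + 1) (by omega)
    have b' := key' (m + 1) (by omega)
    rw [Finset.sum_Icc_succ_top (by omega)] at b b'
    linarith
end

section
/- Let n ≥ 3, let λ_1 ≥ λ_2 ≥ ⋯ ≥ λ_n be integers with Σ_{i=1}^n λ_i = 0, let ν_2 ≥ ν_3 ≥ ⋯ ≥ ν_{n−1} be integers with Σ_{i=2}^{n−1} ν_i = 0, and let ν̃_1 ≥ ν̃_2 ≥ ⋯ ≥ ν̃_n be the nonincreasing rearrangement of the n numbers ν_2, …, ν_{n−1}, 0, 0. Then the following are equivalent: (a) Σ_{i=1}^{k} ν̃_i ≤ Σ_{i=1}^{k} λ_i for every 1 ≤ k ≤ n; (b) Σ_{i=2}^{k} ν_i ≤ min(Σ_{i=1}^{k−1} λ_i, Σ_{i=1}^{k+1} λ_i) for every 2 ≤ k ≤ n−2. -/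
theorem anti_aux (f : ℕ → ℤ) (a b : ℕ) (h : ∀ i, a ≤ i → i < b → f (i + 1) ≤ f i)
    (i j : ℕ) (hi : a ≤ i) (hij : i ≤ j) (hj : j ≤ b) : f j ≤ f i := by
  induction j, hij using Nat.le_induction with
  | base => exact le_rfl
  | succ j hij ih => exact (h j (by omega) (by omega)).trans (ih (by omega))

theorem icc_val_aux (a m : ℕ) : (Finset.Icc (a + 1) (a + m)).val = (List.range' (a + 1) m : Multiset ℕ) := by
  have : Finset.Icc (a + 1) (a + m) = (List.range' (a + 1) m).toFinset := by
    ext x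
    simp [List.mem_range'_1]
    omega
  rw [this, List.toFinset_val, List.dedup_eq_self.2 (List.nodup_range')]

theorem sorted_eq_aux (f g : ℕ → ℤ) (n : ℕ) (hf : ∀ i, 1 ≤ i → i < n → f (i + 1) ≤ f i)
    (hg : ∀ i, 1 ≤ i → i < n → g (i + 1) ≤ g i)
    (h : ((List.range' 1 n).map f).Perm ((List.range' 1 n).map g))
    (i : ℕ) (hi : 1 ≤ i) (hin : i ≤ n) : f i = g i := by
  have key : ∀ f : ℕ → ℤ, (∀ i, 1 ≤ i → i < n → f (i + 1) ≤ f i) →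
      ((List.range' 1 n).map f).Pairwise (· ≥ ·) := by
    intro f hf
    rw [List.pairwise_map]
    have := List.pairwise_lt_range' (s := 1) (n := n)
    refine this.imp_of_mem ?_
    intro a b ha hb hab
    rw [List.mem_range'_1] at ha hb
    exact anti_aux f 1 n hf a b (by omega) hab.le (by omega)
  have e := h.eq_of_pairwise (fun a b _ _ h1 h2 => le_antisymm h2 h1) (key f hf) (key g hg)
  exact List.map_inj_left.1 e i (by rw [List.mem_range'_1]; omega)

theorem split_aux (nu : ℕ → ℤ) (m : ℕ) (h : ∀ i, 2 ≤ i → i < m + 1 → nu (i + 1) ≤ nu i) :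
    ∃ q r, m = q + r ∧ (∀ i, 2 ≤ i → i ≤ q + 1 → 0 ≤ nu i) ∧
      (∀ i, q + 2 ≤ i → i ≤ m + 1 → nu i ≤ 0) := by
  induction m with
  | zero => exact ⟨0, 0, rfl, by intros; omega, by intros; omega⟩
  | succ m ih =>
    obtain ⟨q, r, hm, h1, h2⟩ := ih (fun i a b => h i a (by omega))
    by_cases hc : nu (m + 2) ≤ 0
    · refine ⟨q, r + 1, by omega, h1, ?_⟩
      intro i a b
      by_cases hi : i = m + 2
      · rw [hi]; exact hc
      · exact h2 i a (by omega)
    · refine ⟨m + 1, 0, rfl, ?_, by intros; omega⟩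
      intro i a b
      have := anti_aux nu 2 (m + 2) h i (m + 2) a (by omega) le_rfl
      omega

/-- The type-A branching criterion: let `λ_1 ≥ ⋯ ≥ λ_n` sum to zero, let
`ν_2 ≥ ⋯ ≥ ν_{n-1}` sum to zero, and let `ν̃_1 ≥ ⋯ ≥ ν̃_n` be the nonincreasing
rearrangement of `ν_2, …, ν_{n-1}, 0, 0` (expressed below by requiring `ν̃` to be
nonincreasing on `[1,n]` and its multiset of values there to be that of `ν` on `[2,n-1]`
together with two zeros).  Then the dominance-order condition
`Σ_{i=1}^k ν̃_i ≤ Σ_{i=1}^k λ_i` for all `1 ≤ k ≤ n` is equivalent to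
`Σ_{i=2}^k ν_i ≤ min(Σ_{i=1}^{k-1} λ_i, Σ_{i=1}^{k+1} λ_i)` for all `2 ≤ k ≤ n-2`. -/
theorem stmt19 (n : ℕ) (hn : 3 ≤ n) (lam : ℕ → ℤ)
    (hlam : ∀ i, 1 ≤ i → i < n → lam (i + 1) ≤ lam i)
    (hlsum : ∑ i ∈ Finset.Icc 1 n, lam i = 0)
    (nu : ℕ → ℤ)
    (hnu : ∀ i, 2 ≤ i → i < n - 1 → nu (i + 1) ≤ nu i)
    (hnsum : ∑ i ∈ Finset.Icc 2 (n - 1), nu i = 0)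
    (nut : ℕ → ℤ)
    (hnut : ∀ i, 1 ≤ i → i < n → nut (i + 1) ≤ nut i)
    (hperm : Multiset.map nut (Finset.Icc 1 n).val
      = Multiset.map nu (Finset.Icc 2 (n - 1)).val + ({0, 0} : Multiset ℤ)) :
    (∀ k, 1 ≤ k → k ≤ n →
        ∑ i ∈ Finset.Icc 1 k, nut i ≤ ∑ i ∈ Finset.Icc 1 k, lam i) ↔
    (∀ k, 2 ≤ k → k ≤ n - 2 →
        ∑ i ∈ Finset.Icc 2 k, nu i
          ≤ min (∑ i ∈ Finset.Icc 1 (k - 1), lam i) (∑ i ∈ Finset.Icc 1 (k + 1), lam i)) := by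
  obtain ⟨m, rfl⟩ : ∃ m, n = m + 2 := ⟨n - 2, by omega⟩
  simp only [Nat.add_sub_cancel, show m + 2 - 1 = m + 1 by omega] at *
  obtain ⟨q, r, hm, hq, hr⟩ := split_aux nu m hnu
  have anu := anti_aux nu 2 (m + 1) hnu
  -- the explicit rearrangement
  obtain ⟨mu, hmu⟩ : ∃ mu : ℕ → ℤ, ∀ i, mu i =
      if i ≤ q then nu (i + 1) else if i ≤ q + 2 then 0 else nu (i - 1) := ⟨_, fun _ => rfl⟩
  have hmu1 : ∀ i, i ≤ q → mu i = nu (i + 1) := fun i h => by rw [hmu, if_pos h]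
  have hmu2 : mu (q + 1) = 0 := by rw [hmu, if_neg (by omega), if_pos (by omega)]
  have hmu3 : mu (q + 2) = 0 := by rw [hmu, if_neg (by omega), if_pos (by omega)]
  have hmu4 : ∀ i, q + 2 ≤ i → mu (i + 1) = nu i := fun i h => by
    rw [hmu, if_neg (by omega), if_neg (by omega), Nat.add_sub_cancel]
  have hmuanti : ∀ i, 1 ≤ i → i < m + 2 → mu (i + 1) ≤ mu i := by
    intro i h1 h2
    rcases Nat.lt_trichotomy i q with h | h | h
    · rw [hmu1 _ h, hmu1 _ h.le]; exact hnu _ (by omega) (by omega)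
    · rw [h, hmu2, hmu1 _ le_rfl]; exact hq _ (by omega) (by omega)
    · by_cases h' : i = q + 1
      · rw [h', hmu2, hmu3]
      by_cases h'' : i = q + 2
      · rw [h'', hmu3, hmu4 _ le_rfl]; exact hr _ (by omega) (by omega)
      obtain ⟨j, rfl⟩ : ∃ j, i = j + 1 := ⟨i - 1, by omega⟩
      rw [hmu4 _ (by omega), hmu4 _ (by omega)]; exact hnu _ (by omega) (by omega)
  have hpl : ((List.range' 1 (m + 2)).map nut).Perm ((List.range' 1 (m + 2)).map mu) := by
    have e1 := icc_val_aux 0 (m + 2)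
    have e2 := icc_val_aux 1 m
    rw [Nat.add_comm 1 m] at e2
    simp only [Nat.zero_add, Nat.reduceAdd] at e1 e2
    rw [e1, e2] at hperm
    rw [← Multiset.coe_eq_coe]
    rw [← Multiset.map_coe, hperm]
    have a1 : List.range' 1 (m + 2) = List.range' 1 q ++ ([q + 1, q + 2] ++ List.range' (q + 3) r) := by
      rw [hm, show q + r + 2 = q + (2 + r) by omega, ← List.range'_append_1, ← List.range'_append_1]
      simp [List.range', Nat.add_comm, Nat.add_left_comm]
    have a2 : List.range' 2 m = List.range' 2 q ++ List.range' (q + 2) r := by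
      rw [hm, ← List.range'_append_1, Nat.add_comm 2 q]
    have b1 : (List.range' 1 q).map mu = (List.range' 2 q).map nu := by
      rw [show (2 : ℕ) = 1 + 1 from rfl, ← List.map_add_range' , List.map_map]
      refine List.map_congr_left fun i hi => ?_
      rw [List.mem_range'_1] at hi
      rw [hmu1 _ (by omega)]; simp [Nat.add_comm]
    have b2 : (List.range' (q + 3) r).map mu = (List.range' (q + 2) r).map nu := by
      rw [show q + 3 = 1 + (q + 2) by omega, ← List.map_add_range' , List.map_map]
      refine List.map_congr_left fun i hi => ?_
      rw [List.mem_range'_1] at hi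
      rw [← hmu4 _ (by omega)]; simp [Nat.add_comm]
    rw [a1, a2]
    simp only [List.map_append, b1, b2, List.map_cons, List.map_nil, hmu2, hmu3, Multiset.map_coe,
      ← Multiset.coe_add]
    rw [Multiset.map_add, Multiset.map_coe, Multiset.map_coe, add_assoc]
    congr 1
    rw [add_comm]
    rfl
  have heq := sorted_eq_aux nut mu (m + 2) hnut hmuanti hpl
  -- partial sums
  obtain ⟨L, hL⟩ : ∃ L : ℕ → ℤ, ∀ k, ∑ i ∈ Finset.Icc 1 k, lam i = L k := ⟨_, fun _ => rfl⟩
  obtain ⟨T, hT⟩ : ∃ T : ℕ → ℤ, ∀ k, ∑ i ∈ Finset.Icc 1 k, nut i = T k := ⟨_, fun _ => rfl⟩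
  obtain ⟨N, hN⟩ : ∃ N : ℕ → ℤ, ∀ k, ∑ i ∈ Finset.Icc 2 k, nu i = N k := ⟨_, fun _ => rfl⟩
  have L0 : L 0 = 0 := by rw [← hL]; rfl
  have T0 : T 0 = 0 := by rw [← hT]; rfl
  have N1 : N 1 = 0 := by rw [← hN]; rfl
  have Ls : ∀ k, L (k + 1) = L k + lam (k + 1) := fun k => by
    rw [← hL, ← hL, Finset.sum_Icc_succ_top (by omega)]
  have Ts : ∀ k, T (k + 1) = T k + nut (k + 1) := fun k => by
    rw [← hT, ← hT, Finset.sum_Icc_succ_top (by omega)]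
  have Ns : ∀ k, 1 ≤ k → N (k + 1) = N k + nu (k + 1) := fun k hk => by
    rw [← hN, ← hN, Finset.sum_Icc_succ_top (by omega)]
  simp only [hL, hT, hN, le_min_iff] at *
  have t1 : ∀ k, k ≤ q → T k = N (k + 1) := by
    intro k
    induction k with
    | zero => intro _; rw [T0, N1]
    | succ k ih =>
      intro hk
      rw [Ts, ih (by omega), Ns (k + 1) (by omega), heq _ (by omega) (by omega), hmu1 _ hk]
  have t2 : T (q + 1) = N (q + 1) := by
    rw [Ts, t1 q le_rfl, heq _ (by omega) (by omega), hmu2, add_zero]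
  have t3 : ∀ k, q + 1 ≤ k → k ≤ m + 1 → T (k + 1) = N k := by
    intro k hk
    induction k, hk using Nat.le_induction with
    | base => intro _; rw [Ts, t2, heq _ (by omega) (by omega), hmu3, add_zero]
    | succ k hk ih =>
      intro h
      rw [Ts, ih (by omega), heq _ (by omega) (by omega), hmu4 _ (by omega), Ns k (by omega)]
  have up : ∀ k, 1 ≤ k → k ≤ q → N k ≤ N (k + 1) := by
    intro k h1 h2
    have := hq (k + 1) (by omega) (by omega)
    have := Ns k h1
    omega
  have down : ∀ k, q + 1 ≤ k → k ≤ m → N (k + 1) ≤ N k := by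
    intro k h1 h2
    have := hr (k + 1) (by omega) (by omega)
    have := Ns k (by omega)
    omega
  constructor
  · intro ha k hk1 hk2
    obtain ⟨j, rfl⟩ : ∃ j, k = j + 2 := ⟨k - 2, by omega⟩
    rw [show j + 2 - 1 = j + 1 by omega]
    have c1 := ha (j + 1) (by omega) (by omega)
    have c2 := ha (j + 2 + 1) (by omega) (by omega)
    constructor
    · refine le_trans ?_ c1
      rcases Nat.lt_trichotomy (j + 1) (q + 1) with h | h | h
      · rw [t1 _ (by omega)]
      · have e : j = q := by omega
        subst e
        rw [t2]; exact down _ (by omega) (by omega)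
      · rw [t3 j (by omega) (by omega)]
        exact (down (j + 1) (by omega) (by omega)).trans (down j (by omega) (by omega))
    · refine le_trans ?_ c2
      rcases Nat.lt_trichotomy (j + 3) (q + 1) with h | h | h
      · rw [t1 _ (by omega)]
        exact (up (j + 2) (by omega) (by omega)).trans (up (j + 3) (by omega) (by omega))
      · have e : q = j + 2 := by omega
        subst e
        rw [t2]; exact up _ (by omega) (by omega)
      · rw [t3 (j + 2) (by omega) (by omega)]
  · intro hb
    have alam := anti_aux lam 1 (m + 2) hlam
    -- partial sums of lam are nonnegative
    have Lpos : ∀ k, k ≤ m + 2 → 0 ≤ L k := by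
      intro k hk
      by_cases hc : 0 ≤ lam k ∨ k = 0
      · have : ∀ j, j ≤ k → 0 ≤ L j := by
          intro j
          induction j with
          | zero => intro _; rw [L0]
          | succ j ih =>
            intro hj
            have := ih (by omega)
            have := Ls j
            have := alam (j + 1) k (by omega) hj hk
            omega
        exact this k le_rfl
      · have : ∀ j, k ≤ j → j ≤ m + 2 → L j ≤ L k := by
          intro j hj
          induction j, hj using Nat.le_induction with
          | base => intro _; exact le_rfl
          | succ j hj ih =>
            intro h
            have := ih (by omega)
            have := Ls j
            have := alam k (j + 1) (by omega) (by omega) h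
            omega
        have := this (m + 2) hk le_rfl
        omega
    have hb1 : ∀ k, 1 ≤ k → k ≤ m + 1 → N k ≤ L (k - 1) ∧ N k ≤ L (k + 1) := by
      intro k h1 h2
      by_cases e1 : k = 1
      · subst e1; rw [N1]; exact ⟨Lpos _ (by omega), Lpos _ (by omega)⟩
      by_cases e2 : k = m + 1
      · subst e2; rw [hnsum]; exact ⟨Lpos _ (by omega), Lpos _ (by omega)⟩
      exact hb k (by omega) (by omega)
    intro k h1 h2
    rcases Nat.lt_trichotomy k (q + 1) with h | h | h
    · rw [t1 _ (by omega)]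
      exact (hb1 (k + 1) (by omega) (by omega)).1
    · subst h
      rw [t2]
      have h3 := hb1 (q + 1) (by omega) (by omega)
      rw [Nat.add_sub_cancel] at h3
      have := Ls q
      have := Ls (q + 1)
      have := hlam (q + 1) (by omega) (by omega)
      omega
    · obtain ⟨j, rfl⟩ : ∃ j, k = j + 1 := ⟨k - 1, by omega⟩
      rw [t3 _ (by omega) (by omega)]
      exact (hb1 j (by omega) (by omega)).2
end
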